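/- Let f be a square integrable function on (X^{k_1}, 𝒳^{k_1}, μ^{k_1}) and g a square integrable function on (X^{k_2}, 𝒳^{k_2}, μ^{k_2}). Then for every coloured diagram B(𝒩,𝒩₁) with 𝒩₁ = 𝒩 (a Gaussian diagram) one has ‖ f∘g_{B(𝒩,𝒩)} ‖_2^2 ≤ ‖f‖_2^2 · ‖g‖_2^2. -/

import Mathlib

open MeasureTheory
open scoped ENNReal Classical

noncomputable section

namespace EmpInt

variable {X : Type*} [MeasurableSpace X] [Nonempty X]

/-- The substitution operators `R_{j,j'}`: for every edge `(a s, b s)` the variable with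
index `b s` (in the second row) is replaced by the variable with index `a s` (first row). -/
def subFun {k₁ k₂ l : ℕ} (a : Fin l → Fin k₁) (b : Fin l → Fin k₂)
    (x : Fin k₁ → X) (y : Fin k₂ → X) : Fin k₂ → X :=
  fun j => if h : ∃ s, b s = j then x (a (Classical.choose h)) else y j

/-- The function `\overline{f∘g}_{B(𝒩,𝒩₁)}`: apply the substitutions `R_{a s, b s}` for all
edges `s`, then integrate out (operators `P_{a s}`) the first-row variables of the coloured
edges `s ∈ c`; a function of the remaining variables. -/
def diagAux (μ : Measure X) {k₁ k₂ l : ℕ} (f : (Fin k₁ → X) → ℝ) (g : (Fin k₂ → X) → ℝ)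
    (a : Fin l → Fin k₁) (b : Fin l → Fin k₂) (c : Finset (Fin l))
    (xr : {i : Fin k₁ // i ∉ c.image a} → X)
    (yr : {j : Fin k₂ // j ∉ Finset.image b Finset.univ} → X) : ℝ :=
  ∫ w : Fin k₁ → X,
    (fun x : Fin k₁ → X =>
        f x * g (subFun a b x fun j =>
          if h : j ∉ Finset.image b Finset.univ then yr ⟨j, h⟩ else Classical.arbitrary X))
      (fun i => if h : i ∉ c.image a then xr ⟨i, h⟩ else w i)
    ∂(Measure.pi fun _ : Fin k₁ => μ)

/-- The rank of `i` in the finset `T`, i.e. the number of elements of `T` smaller than `i`;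
used to relabel the remaining variables in increasing order of their original indices. -/
def rankIn {m : ℕ} (T : Finset (Fin m)) (i : Fin m) : ℕ := (T.filter (· < i)).card

/-- The set of indices (inside `{1,…,k₁+k₂}`) of the variables remaining after applying the
operators prescribed by the coloured diagram. -/
def remainingSet (k₁ k₂ l : ℕ) (a : Fin l → Fin k₁) (b : Fin l → Fin k₂)
    (c : Finset (Fin l)) : Finset (Fin (k₁ + k₂)) :=
  ((Finset.univ.filter fun i : Fin k₁ => i ∉ c.image a).image (Fin.castAdd k₂)) ∪
    ((Finset.univ.filter fun j : Fin k₂ => j ∉ Finset.image b Finset.univ).image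
      (Fin.natAdd k₁))

/-- The function `f∘g_{B(𝒩,𝒩₁)}` of the coloured diagram with edges `(a s, b s)`,
`s = 1,…,l`, coloured subset `c`, with the remaining variables relabelled as
`x_1, x_2, …` in increasing order of their original indices. -/
def diagFun (μ : Measure X) {k₁ k₂ l : ℕ} (f : (Fin k₁ → X) → ℝ) (g : (Fin k₂ → X) → ℝ)
    (a : Fin l → Fin k₁) (b : Fin l → Fin k₂) (c : Finset (Fin l)) (m : ℕ) :
    (Fin m → X) → ℝ := fun z =>
  diagAux μ f g a b c
    (fun i =>
      if h : rankIn (remainingSet k₁ k₂ l a b c) (Fin.castAdd k₂ i.1) < m then z ⟨_, h⟩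
      else Classical.arbitrary X)
    (fun j =>
      if h : rankIn (remainingSet k₁ k₂ l a b c) (Fin.natAdd k₁ j.1) < m then z ⟨_, h⟩
      else Classical.arbitrary X)

end EmpInt

namespace EmpInt

section MeasurePreserving

variable {X : Type*} [MeasurableSpace X] {μ : Measure X} [IsProbabilityMeasure μ]

/-- Relabelling the coordinates along an injection preserves powers of a probability measure. -/
theorem measurePreserving_comp_injective {ι κ : Type*} [Fintype ι] [Fintype κ]
    {ρ : κ → ι} (hρ : Function.Injective ρ) :
    MeasurePreserving (fun (z : ι → X) (k : κ) => z (ρ k))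
      (Measure.pi fun _ : ι => μ) (Measure.pi fun _ : κ => μ) := by
  have hm : Measurable fun (z : ι → X) (k : κ) => z (ρ k) := by fun_prop
  refine ⟨hm, ?_⟩
  have hind := (ProbabilityTheory.iIndepFun_pi (μ := fun _ : ι => μ) (X := fun _ => id)
    fun _ => aemeasurable_id).precomp hρ
  have h := (ProbabilityTheory.iIndepFun_iff_map_fun_eq_pi_map (fun k => by
    exact (measurable_pi_apply (ρ k)).aemeasurable)).1 hind
  refine h.trans ?_
  congr 1
  funext k
  exact (measurePreserving_eval (fun _ : ι => μ) (ρ k)).map_eq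

theorem measurePreserving_sumElim_comp {ι₁ ι₂ κ : Type*} [Fintype ι₁] [Fintype ι₂] [Fintype κ]
    {ρ : κ → ι₁ ⊕ ι₂} (hρ : Function.Injective ρ) :
    MeasurePreserving (fun (p : (ι₁ → X) × (ι₂ → X)) (k : κ) => Sum.elim p.1 p.2 (ρ k))
      ((Measure.pi fun _ : ι₁ => μ).prod (Measure.pi fun _ : ι₂ => μ))
      (Measure.pi fun _ : κ => μ) := by
  have h := (measurePreserving_comp_injective (μ := μ) hρ).comp
    (measurePreserving_sumPiEquivProdPi_symm (X := fun _ : ι₁ ⊕ ι₂ => X) fun _ => μ)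
  convert h using 1
  funext p k
  simp only [Function.comp_apply]
  generalize ρ k = s
  cases s <;> rfl

theorem measurePreserving_comp_prodMk {ι₁ ι₂ κ : Type*} [Fintype ι₁] [Fintype ι₂] [Fintype κ]
    {σ : ι₁ → κ} {τ : ι₂ → κ} (h : Function.Injective (Sum.elim σ τ)) :
    MeasurePreserving (fun z : κ → X => (fun i => z (σ i), fun j => z (τ j)))
      (Measure.pi fun _ : κ => μ)
      ((Measure.pi fun _ : ι₁ => μ).prod (Measure.pi fun _ : ι₂ => μ)) :=
  (measurePreserving_sumPiEquivProdPi (X := fun _ : ι₁ ⊕ ι₂ => X) fun _ => μ).comp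
    (measurePreserving_comp_injective (μ := μ) h)

theorem measurable_sumElim_comp {ι₁ ι₂ κ : Type*} (ρ : κ → ι₁ ⊕ ι₂) :
    Measurable fun (p : (ι₁ → X) × (ι₂ → X)) (k : κ) => Sum.elim p.1 p.2 (ρ k) := by
  refine measurable_pi_lambda _ fun k => ?_
  cases ρ k <;> simp only [Sum.elim_inl, Sum.elim_inr] <;> fun_prop

end MeasurePreserving

theorem sq_lintegral_mul_le {Ω : Type*} [MeasurableSpace Ω] (ν : Measure Ω) {u v : Ω → ℝ≥0∞}
    (hu : AEMeasurable u ν) (hv : AEMeasurable v ν) :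
    (∫⁻ ω, u ω * v ω ∂ν) ^ 2 ≤ (∫⁻ ω, u ω ^ 2 ∂ν) * ∫⁻ ω, v ω ^ 2 ∂ν := by
  have h := ENNReal.lintegral_mul_le_Lp_mul_Lq ν Real.HolderConjugate.two_two hu hv
  simp only [Pi.mul_apply, ENNReal.rpow_two] at h
  calc _ ≤ _ := pow_le_pow_left' h 2
    _ = _ := by
      rw [mul_pow, ← ENNReal.rpow_mul_natCast, ← ENNReal.rpow_mul_natCast]
      norm_num

/-- Contracting two kernels over shared variables does not increase the product of their
squared `L²`-norms. -/
theorem lintegral_sq_contraction_le {X : Type*} [MeasurableSpace X] (μ : Measure X)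
    [IsProbabilityMeasure μ] {ι₁ ι₂ κ κ₁ κ₂ ι : Type*} [Fintype ι₁] [Fintype ι₂] [Fintype κ]
    [Fintype κ₁] [Fintype κ₂] [Fintype ι]
    {f : (κ₁ → X) → ℝ} {g : (κ₂ → X) → ℝ} (hf : Measurable f) (hg : Measurable g)
    {ρ₁ : κ₁ → ι₁ ⊕ κ} {ρ₂ : κ₂ → ι₂ ⊕ κ} (hρ₁ : Function.Injective ρ₁)
    (hρ₂ : Function.Injective ρ₂) {σ : ι₁ → ι} {τ : ι₂ → ι}
    (hστ : Function.Injective (Sum.elim σ τ)) :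
    ∫⁻ z : ι → X, ‖∫ w : κ → X, f (fun k => Sum.elim (fun i => z (σ i)) w (ρ₁ k)) *
          g (fun k => Sum.elim (fun j => z (τ j)) w (ρ₂ k)) ∂Measure.pi fun _ => μ‖ₑ ^ 2
        ∂Measure.pi (fun _ => μ) ≤
      (∫⁻ x, ‖f x‖ₑ ^ 2 ∂Measure.pi fun _ => μ) * ∫⁻ y, ‖g y‖ₑ ^ 2 ∂Measure.pi fun _ => μ := by
  have hF : Measurable fun p : (ι₁ → X) × (κ → X) =>
      ‖f (fun k => Sum.elim p.1 p.2 (ρ₁ k))‖ₑ ^ 2 :=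
    ((hf.comp (measurable_sumElim_comp ρ₁)).enorm).pow_const 2
  have hG : Measurable fun p : (ι₂ → X) × (κ → X) =>
      ‖g (fun k => Sum.elim p.1 p.2 (ρ₂ k))‖ₑ ^ 2 :=
    ((hg.comp (measurable_sumElim_comp ρ₂)).enorm).pow_const 2
  have hF' := hF.lintegral_prod_right' (ν := Measure.pi fun _ : κ => μ)
  have hG' := hG.lintegral_prod_right' (ν := Measure.pi fun _ : κ => μ)
  calc
    _ ≤ ∫⁻ z : ι → X,
        (∫⁻ w : κ → X, ‖f (fun k => Sum.elim (fun i => z (σ i)) w (ρ₁ k))‖ₑ ^ 2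
          ∂Measure.pi fun _ => μ) *
        (∫⁻ w : κ → X, ‖g (fun k => Sum.elim (fun j => z (τ j)) w (ρ₂ k))‖ₑ ^ 2
          ∂Measure.pi fun _ => μ) ∂Measure.pi (fun _ => μ) := by
      refine lintegral_mono fun z => ?_
      refine (pow_le_pow_left' (enorm_integral_le_lintegral_enorm _) 2).trans ?_
      simp only [enorm_mul]
      exact sq_lintegral_mul_le _
        ((hf.comp ((measurable_sumElim_comp ρ₁).comp measurable_prodMk_left)).enorm.aemeasurable)
        ((hg.comp ((measurable_sumElim_comp ρ₂).comp measurable_prodMk_left)).enorm.aemeasurable)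
    _ = ∫⁻ p : (ι₁ → X) × (ι₂ → X),
        (∫⁻ w : κ → X, ‖f (fun k => Sum.elim p.1 w (ρ₁ k))‖ₑ ^ 2 ∂Measure.pi fun _ => μ) *
        (∫⁻ w : κ → X, ‖g (fun k => Sum.elim p.2 w (ρ₂ k))‖ₑ ^ 2 ∂Measure.pi fun _ => μ)
        ∂(Measure.pi fun _ => μ).prod (Measure.pi fun _ => μ) :=
      (measurePreserving_comp_prodMk (μ := μ) hστ).lintegral_comp
        ((hF'.comp measurable_fst).mul (hG'.comp measurable_snd))
    _ = _ := by
      rw [lintegral_prod_mul hF'.aemeasurable hG'.aemeasurable, ← lintegral_prod _ hF.aemeasurable,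
        ← lintegral_prod _ hG.aemeasurable,
        (measurePreserving_sumElim_comp (μ := μ) hρ₁).lintegral_comp (hf.enorm.pow_const 2),
        (measurePreserving_sumElim_comp (μ := μ) hρ₂).lintegral_comp (hg.enorm.pow_const 2)]

theorem rankIn_lt_rankIn {m : ℕ} {T : Finset (Fin m)} {i j : Fin m} (hi : i ∈ T) (hij : i < j) :
    rankIn T i < rankIn T j := by
  refine Finset.card_lt_card (Finset.ssubset_iff_of_subset ?_ |>.2 ⟨i, ?_, ?_⟩)
  · intro k hk
    simp only [Finset.mem_filter] at hk ⊢
    exact ⟨hk.1, hk.2.trans hij⟩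
  · simp [hi, hij]
  · simp

theorem rankIn_injOn {m : ℕ} (T : Finset (Fin m)) : Set.InjOn (rankIn T) T := by
  intro i hi j hj h
  by_contra hne
  rcases lt_or_gt_of_ne hne with hlt | hlt
  · exact (rankIn_lt_rankIn hi hlt).ne h
  · exact (rankIn_lt_rankIn hj hlt).ne' h

theorem rankIn_lt_card {m : ℕ} {T : Finset (Fin m)} {i : Fin m} (hi : i ∈ T) :
    rankIn T i < T.card :=
  Finset.card_lt_card (Finset.filter_ssubset.2 ⟨i, hi, lt_irrefl i⟩)

section Diagram

variable {k₁ k₂ l : ℕ} {a : Fin l → Fin k₁} {b : Fin l → Fin k₂}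

theorem card_remainingSet_univ (ha : Function.Injective a) (hb : Function.Injective b) :
    (remainingSet k₁ k₂ l a b Finset.univ).card = k₁ + k₂ - l - l := by
  have h₁ : l ≤ k₁ := by simpa using Fintype.card_le_of_injective a ha
  have h₂ : l ≤ k₂ := by simpa using Fintype.card_le_of_injective b hb
  unfold remainingSet
  rw [Finset.card_union_of_disjoint, Finset.card_image_of_injective _ (Fin.castAdd_injective _ _),
    Finset.card_image_of_injective _ (Fin.natAdd_injective _ _)]
  · have hcompl {n : ℕ} (S : Finset (Fin n)) : Finset.univ.filter (· ∉ S) = Sᶜ := by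
      ext; simp
    rw [hcompl, hcompl, Finset.card_compl, Finset.card_compl,
      Finset.card_image_of_injective _ ha, Finset.card_image_of_injective _ hb,
      Finset.card_univ, Fintype.card_fin, Fintype.card_fin, Fintype.card_fin]
    omega
  · rw [Finset.disjoint_left]
    intro i hi hj
    simp only [Finset.mem_image] at hi hj
    obtain ⟨i, -, rfl⟩ := hi
    obtain ⟨j, -, h⟩ := hj
    have := congrArg Fin.val h
    simp at this
    omega

theorem castAdd_mem_remainingSet {c : Finset (Fin l)} {i : Fin k₁} (hi : i ∉ c.image a) :
    Fin.castAdd k₂ i ∈ remainingSet k₁ k₂ l a b c :=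
  Finset.mem_union_left _ (Finset.mem_image_of_mem _ (by simpa using hi))

theorem natAdd_mem_remainingSet {c : Finset (Fin l)} {j : Fin k₂}
    (hj : j ∉ Finset.image b Finset.univ) :
    Fin.natAdd k₁ j ∈ remainingSet k₁ k₂ l a b c :=
  Finset.mem_union_right _ (Finset.mem_image_of_mem _ (by simpa using hj))

end Diagram

theorem lintegral_sq_diagFun_univ_le {X : Type*} [MeasurableSpace X] [Nonempty X]
    (μ : Measure X) [IsProbabilityMeasure μ] {k₁ k₂ l : ℕ}
    {a : Fin l → Fin k₁} {b : Fin l → Fin k₂}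
    (ha : Function.Injective a) (hb : Function.Injective b)
    {f : (Fin k₁ → X) → ℝ} {g : (Fin k₂ → X) → ℝ} (hf : Measurable f) (hg : Measurable g) :
    ∫⁻ z, ‖diagFun μ f g a b Finset.univ (k₁ + k₂ - l - l) z‖ₑ ^ 2 ∂(Measure.pi fun _ => μ) ≤
      (∫⁻ x, ‖f x‖ₑ ^ 2 ∂Measure.pi fun _ => μ) * ∫⁻ y, ‖g y‖ₑ ^ 2 ∂Measure.pi fun _ => μ := by
  set T := remainingSet k₁ k₂ l a b Finset.univ with hT
  have hcard : T.card = k₁ + k₂ - l - l := card_remainingSet_univ ha hb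
  have h₁ (i : {i : Fin k₁ // i ∉ Finset.univ.image a}) : Fin.castAdd k₂ i.1 ∈ T :=
    castAdd_mem_remainingSet i.2
  have h₂ (j : {j : Fin k₂ // j ∉ Finset.univ.image b}) : Fin.natAdd k₁ j.1 ∈ T :=
    natAdd_mem_remainingSet j.2
  have hlt {i} (hi : i ∈ T) : rankIn T i < k₁ + k₂ - l - l := hcard ▸ rankIn_lt_card hi
  let σ (i : {i : Fin k₁ // i ∉ Finset.univ.image a}) : Fin (k₁ + k₂ - l - l) := ⟨_, hlt (h₁ i)⟩
  let τ (j : {j : Fin k₂ // j ∉ Finset.univ.image b}) : Fin (k₁ + k₂ - l - l) := ⟨_, hlt (h₂ j)⟩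
  have hστ : Function.Injective (Sum.elim σ τ) := by
    rintro (i | i) (j | j) h <;> have h := congrArg Fin.val h
    · have := rankIn_injOn T (h₁ i) (h₁ j) h
      exact congrArg _ (Subtype.ext (Fin.castAdd_injective _ _ this))
    · have := congrArg Fin.val (rankIn_injOn T (h₁ i) (h₂ j) h)
      simp at this
      omega
    · have := congrArg Fin.val (rankIn_injOn T (h₂ i) (h₁ j) h)
      simp at this
      omega
    · have := rankIn_injOn T (h₂ i) (h₂ j) h
      exact congrArg _ (Subtype.ext (Fin.natAdd_injective _ _ this))
  let ρ₁ (i : Fin k₁) : {i : Fin k₁ // i ∉ Finset.univ.image a} ⊕ Fin k₁ :=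
    if h : i ∉ Finset.univ.image a then .inl ⟨i, h⟩ else .inr i
  let ρ₂ (j : Fin k₂) : {j : Fin k₂ // j ∉ Finset.univ.image b} ⊕ Fin k₁ :=
    if h : ∃ s, b s = j then .inr (a h.choose) else .inl ⟨j, by simpa using h⟩
  have hρ₁ : Function.Injective ρ₁ := by
    intro i j h
    simp only [ρ₁] at h
    split_ifs at h <;> simpa using h
  have hρ₂ : Function.Injective ρ₂ := by
    intro i j h
    simp only [ρ₂] at h
    split_ifs at h with hi hj hj
    · rw [← hi.choose_spec, ← hj.choose_spec, ha (Sum.inr_injective h)]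
    · simpa using h
  refine le_trans (lintegral_mono fun z => le_of_eq ?_)
    (lintegral_sq_contraction_le μ hf hg hρ₁ hρ₂ hστ)
  simp only [diagFun, diagAux]
  congr 3
  funext w
  congr 2
  · funext i
    by_cases hi : i ∈ Finset.univ.image a
    · rw [dif_neg (not_not.2 hi)]
      simp only [ρ₁, dif_neg (not_not.2 hi), Sum.elim_inr]
    · rw [dif_pos hi, dif_pos (hlt (h₁ ⟨i, hi⟩))]
      simp only [ρ₁, dif_pos hi, Sum.elim_inl, σ, T]
  · funext j
    by_cases hj : ∃ s, b s = j
    · have ha' : a hj.choose ∈ Finset.univ.image a :=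
        Finset.mem_image_of_mem a (Finset.mem_univ _)
      simp only [ρ₂, subFun, dif_pos hj, Sum.elim_inr]
      rw [dif_neg (not_not.2 ha')]
    · have hj' : j ∉ Finset.univ.image b := by simpa using hj
      simp only [ρ₂, subFun, dif_neg hj, Sum.elim_inl, τ]
      rw [dif_pos hj', dif_pos (hlt (h₂ ⟨j, hj'⟩))]

end EmpInt

/-- Formula (3.15): for square integrable `f` and `g` and a Gaussian coloured diagram
(`𝒩₁ = 𝒩`), `‖f∘g_{B(𝒩,𝒩)}‖_2^2 ≤ ‖f‖_2^2·‖g‖_2^2`. -/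
theorem kernel_L2_bound_gaussian
    (X : Type) [MeasurableSpace X] [Nonempty X] (μ : Measure X) [IsProbabilityMeasure μ]
    (k₁ k₂ l : ℕ) (hk₁ : 1 ≤ k₁) (hk₂ : 1 ≤ k₂)
    (a : Fin l → Fin k₁) (b : Fin l → Fin k₂)
    (ha : Function.Injective a) (hb : Function.Injective b)
    (f : (Fin k₁ → X) → ℝ) (g : (Fin k₂ → X) → ℝ)
    (hf : Measurable f) (hg : Measurable g)
    (hf2 : Integrable (fun x => f x ^ 2) (Measure.pi fun _ : Fin k₁ => μ))
    (hg2 : Integrable (fun y => g y ^ 2) (Measure.pi fun _ : Fin k₂ => μ)) :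
    ∫ z, (EmpInt.diagFun μ f g a b (Finset.univ : Finset (Fin l)) (k₁ + k₂ - l - l) z) ^ 2
        ∂(Measure.pi fun _ : Fin (k₁ + k₂ - l - l) => μ) ≤
      (∫ x, f x ^ 2 ∂(Measure.pi fun _ : Fin k₁ => μ)) *
        ∫ y, g y ^ 2 ∂(Measure.pi fun _ : Fin k₂ => μ) := by
  have hsq {n : ℕ} {h : (Fin n → X) → ℝ}
      (hi : Integrable (fun x => h x ^ 2) (Measure.pi fun _ : Fin n => μ)) :
      ∫⁻ x, ‖h x‖ₑ ^ 2 ∂(Measure.pi fun _ : Fin n => μ) =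
        ENNReal.ofReal (∫ x, h x ^ 2 ∂(Measure.pi fun _ : Fin n => μ)) := by
    have := ofReal_integral_norm_eq_lintegral_enorm hi
    simpa only [norm_pow, enorm_pow, Real.norm_eq_abs, sq_abs] using this.symm
  have hle := (enorm_integral_le_lintegral_enorm _).trans
    ((lintegral_mono fun z => (enorm_pow _ 2).le).trans
      (EmpInt.lintegral_sq_diagFun_univ_le μ ha hb hf hg))
  rw [hsq hf2, hsq hg2, ← ENNReal.ofReal_mul (integral_nonneg fun x => sq_nonneg _),
    Real.enorm_eq_ofReal_abs, ENNReal.ofReal_le_ofReal_iff (mul_nonneg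
      (integral_nonneg fun x => sq_nonneg _) (integral_nonneg fun y => sq_nonneg _))] at hle
  exact (le_abs_self _).trans hle
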